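/- arXiv:2310.05142 — 2 statements merged into one kernel-verified Lean document; each statement's English description precedes it below -/
import Mathlib

section
/- For all real numbers x, y, x₀, y₀ with x > 0, y > 0, x₀ > 0, y₀ > 0, the inequality −(x·y₀ + x₀·y − 3·x₀·y₀)/(x₀²·y₀²) ≤ 1/(x·y) holds. (This is Lemma 1 of the paper: the first-order Taylor expansion of f(x,y) = 1/(xy) at (x₀, y₀) is a global lower bound on f over the positive orthant.) -/
/-- The arithmetic-geometric mean inequality for `a ^ 2 * b`, `a * b ^ 2` and `c ^ 3`. -/
theorem three_mul_sub_sub_mul_mul_le_cube {a b c : ℝ} (ha : 0 ≤ a) (hb : 0 ≤ b) (hc : 0 ≤ c) :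
    (3 * c - a - b) * (a * b) ≤ c ^ 3 := by
  rcases le_total (3 * c - a - b) 0 with h | h
  · exact (mul_nonpos_of_nonpos_of_nonneg h (mul_nonneg ha hb)).trans (pow_nonneg hc 3)
  · have h₁ : 0 ≤ (3 * c - a - b) * (a - b) ^ 2 := mul_nonneg h (sq_nonneg _)
    have h₂ : 0 ≤ (a + b + c) * (a + b - 2 * c) ^ 2 := by positivity
    linarith

/-- Lemma 1: the first-order Taylor expansion of `f(x,y) = 1/(x*y)` at `(x₀, y₀)`
is a global lower bound on `f` over the positive orthant. -/
theorem taylor_lower_bound_inv_mul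
    (x y x₀ y₀ : ℝ) (hx : 0 < x) (hy : 0 < y) (hx₀ : 0 < x₀) (hy₀ : 0 < y₀) :
    -(x * y₀ + x₀ * y - 3 * x₀ * y₀) / (x₀ ^ 2 * y₀ ^ 2) ≤ 1 / (x * y) := by
  rw [div_le_div_iff₀ (by positivity) (by positivity)]
  refine le_of_mul_le_mul_right ?_ (mul_pos hx₀ hy₀)
  have h := three_mul_sub_sub_mul_mul_le_cube (mul_pos hx hy₀).le (mul_pos hx₀ hy).le
    (mul_pos hx₀ hy₀).le
  linarith
end

section
/- Let (Ω, μ) be a probability space and let ζ : Ω → ℝ be an integrable random variable with ζ ≥ 0 almost everywhere and 𝔼[ζ] = 1. Then for every real c > 0, 𝔼[√(1 − (1 + c·ζ)⁻²)] ≤ √(1 − (1 + c)⁻²). -/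
open MeasureTheory

/-- Tangent-line bound for the convex function `u ↦ u⁻²` on the positive half-line. -/
theorem inv_sq_tangent_le {a u : ℝ} (ha : 0 < a) (hu : 0 < u) :
    (a ^ 2)⁻¹ - 2 * (u - a) / a ^ 3 ≤ (u ^ 2)⁻¹ := by
  have key : (u ^ 2)⁻¹ - ((a ^ 2)⁻¹ - 2 * (u - a) / a ^ 3) =
      (a - u) ^ 2 * (a + 2 * u) / (u ^ 2 * a ^ 3) := by
    field_simp
    ring
  have : 0 ≤ (a - u) ^ 2 * (a + 2 * u) / (u ^ 2 * a ^ 3) := by positivity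
  linarith

/-- Tangent-line bound for the concave function `u ↦ √(1 - u⁻²)` on `[1, ∞)`. -/
theorem sqrt_one_sub_inv_sq_le_tangent {a u : ℝ} (ha : 1 < a) (hu : 1 ≤ u) :
    Real.sqrt (1 - (u ^ 2)⁻¹) ≤ Real.sqrt (1 - (a ^ 2)⁻¹) +
      (Real.sqrt (1 - (a ^ 2)⁻¹) * a ^ 3)⁻¹ * (u - a) := by
  have hV : 0 < 1 - (a ^ 2)⁻¹ := sub_pos.2 (inv_lt_one_of_one_lt₀ (one_lt_pow₀ ha two_ne_zero))
  have hh : 0 ≤ 1 - (u ^ 2)⁻¹ := sub_nonneg.2 (inv_le_one_of_one_le₀ (one_le_pow₀ hu))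
  have hs := Real.sqrt_pos.2 hV
  have hs2 := Real.sq_sqrt hV.le
  have ht2 := Real.sq_sqrt hh
  have htan := inv_sq_tangent_le (zero_lt_one.trans ha) (zero_lt_one.trans_le hu)
  set s := Real.sqrt (1 - (a ^ 2)⁻¹)
  set t := Real.sqrt (1 - (u ^ 2)⁻¹)
  have ha0 : 0 < a := zero_lt_one.trans ha
  have hmul : s * (s + (s * a ^ 3)⁻¹ * (u - a)) = s ^ 2 + (u - a) / a ^ 3 := by
    field_simp
  refine le_of_mul_le_mul_left ?_ hs
  rw [hmul]
  rw [mul_div_assoc] at htan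
  nlinarith [sq_nonneg (t - s)]

/-- Jensen step for the dispersion term: if `ζ ≥ 0` a.e. is integrable with mean `1`
on a probability space, then for every `c > 0`,
`𝔼[√(1 − (1 + c·ζ)⁻²)] ≤ √(1 − (1 + c)⁻²)`. -/
theorem expectation_sqrt_dispersion_le
    {Ω : Type*} [MeasurableSpace Ω] (μ : Measure Ω) [IsProbabilityMeasure μ]
    (ζ : Ω → ℝ) (hint : Integrable ζ μ) (hpos : ∀ᵐ ω ∂μ, 0 ≤ ζ ω)
    (hmean : ∫ ω, ζ ω ∂μ = 1) (c : ℝ) (hc : 0 < c) :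
    ∫ ω, Real.sqrt (1 - ((1 + c * ζ ω) ^ 2)⁻¹) ∂μ ≤
      Real.sqrt (1 - ((1 + c) ^ 2)⁻¹) := by
  set s := Real.sqrt (1 - ((1 + c) ^ 2)⁻¹) with hs
  set k := (s * (1 + c) ^ 3)⁻¹ * c with hk
  have hlin : Integrable (fun ω => k * (ζ ω - 1)) μ :=
    (hint.sub (integrable_const 1)).const_mul k
  calc ∫ ω, Real.sqrt (1 - ((1 + c * ζ ω) ^ 2)⁻¹) ∂μ
      ≤ ∫ ω, (s + k * (ζ ω - 1)) ∂μ := by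
        refine integral_mono_of_nonneg (.of_forall fun _ => Real.sqrt_nonneg _)
          ((integrable_const s).add hlin) ?_
        filter_upwards [hpos] with ω hω
        have h := sqrt_one_sub_inv_sq_le_tangent (a := 1 + c) (u := 1 + c * ζ ω)
          (by linarith) (by linarith [mul_nonneg hc.le hω])
        rw [← hs] at h
        exact h.trans_eq (by rw [hk]; ring)
    _ = s := by
        rw [integral_add (integrable_const s) hlin, integral_const_mul,
          integral_sub hint (integrable_const 1), hmean]
        simp
end
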